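/- Let (ρ_{AB}, {Π^i}_{i=1}^N, {D^i}_{i=1}^N) define both a |C|-dimensional teleportation protocol with teleportation channel Λ and an N-message dense coding protocol with classical channel W given by transition probabilities p(j|i) = tr(Π^j ω^i), where ω^i = (id_A⊗D^i)(ρ_{AB}). Then the entanglement fidelity F(Λ) and the classical correlation fidelity F_cl(W) = (1/N) ∑_{i=1}^N p(i|i) satisfy F(Λ) = (N/|C|²)·F_cl(W). -/

import Mathlib

open Matrix BigOperators Finset
open scoped Kronecker ComplexOrder

noncomputable section

/-- Partial trace over the second tensor factor. -/
def ptraceB {α β : Type*} [Fintype β] (M : Matrix (α × β) (α × β) ℂ) :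
    Matrix α α ℂ :=
  Matrix.of fun a a' => ∑ b, M (a, b) (a', b)

/-- `ρ ↦ ∑ k (I ⊗ K k) ρ (I ⊗ K k)†`: a Kraus-operator channel `B → C` applied to the
second factor of a bipartite matrix on `A ⊗ B`. -/
def idKrausApply {a b c : ℕ} {m : ℕ} (K : Fin m → Matrix (Fin c) (Fin b) ℂ)
    (ρ : Matrix (Fin a × Fin b) (Fin a × Fin b) ℂ) :
    Matrix (Fin a × Fin c) (Fin a × Fin c) ℂ :=
  ∑ k, ((1 : Matrix (Fin a) (Fin a) ℂ) ⊗ₖ K k) * ρ *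
      ((1 : Matrix (Fin a) (Fin a) ℂ) ⊗ₖ K k)ᴴ

/-- The teleportation channel `Λ(σ) = ∑ i tr_{AC'}[(Πᵢ ⊗ I_C)(σ ⊗ ωᵢ)]`, written entrywise. -/
def teleChannel {a c N : ℕ}
    (Pv ω : Fin N → Matrix (Fin a × Fin c) (Fin a × Fin c) ℂ)
    (σ : Matrix (Fin c) (Fin c) ℂ) : Matrix (Fin c) (Fin c) ℂ :=
  Matrix.of fun x y =>
    ∑ i, ∑ a₁ : Fin a, ∑ x₁ : Fin c, ∑ a₂ : Fin a, ∑ x₂ : Fin c,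
      Pv i (a₁, x₁) (a₂, x₂) * σ x₂ x₁ * ω i (a₂, x) (a₁, y)

/-- The maximally entangled state `|Φ⁺⟩⟨Φ⁺|` with `|Φ⁺⟩ = c^{-1/2} ∑ᵢ |i⟩|i⟩`. -/
def maxEnt (c : ℕ) : Matrix (Fin c × Fin c) (Fin c × Fin c) ℂ :=
  Matrix.of fun p q => if p.1 = p.2 ∧ q.1 = q.2 then (1 : ℂ) / c else 0

/-- `(id ⊗ Λ)(M)`, written entrywise (this is the correct formula for linear `Λ`). -/
def idOnFirst {c d : ℕ} (Λ : Matrix (Fin c) (Fin c) ℂ → Matrix (Fin c) (Fin c) ℂ)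
    (M : Matrix (Fin d × Fin c) (Fin d × Fin c) ℂ) :
    Matrix (Fin d × Fin c) (Fin d × Fin c) ℂ :=
  Matrix.of fun p q => Λ (Matrix.of fun x y => M (p.1, x) (q.1, y)) p.2 q.2

/-- Entanglement fidelity `F(Λ) = tr[Φ⁺ (id ⊗ Λ)(Φ⁺)]` of the teleportation channel
determined by the POVM `Pv` and the encoded states `ω`. -/
def entFid {a c N : ℕ}
    (Pv ω : Fin N → Matrix (Fin a × Fin c) (Fin a × Fin c) ℂ) : ℂ :=
  Matrix.trace (maxEnt c * idOnFirst (teleChannel Pv ω) (maxEnt c))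

/-- Mutual information (base 2) of a joint probability distribution on a product of
finite sets; terms with `p x y = 0` vanish since `0 * log = 0`. -/
def mutInfo {X Y : Type*} [Fintype X] [Fintype Y] (p : X → Y → ℝ) : ℝ :=
  ∑ x, ∑ y, p x y * Real.logb 2 (p x y / ((∑ y', p x y') * (∑ x', p x' y)))

/-- Binary entropy (base 2). -/
def binEnt (p : ℝ) : ℝ := -(p * Real.logb 2 p) - (1 - p) * Real.logb 2 (1 - p)

/-- The swap operator on `ℂ^d ⊗ ℂ^d`. -/
def swapOp (d : ℕ) : Matrix (Fin d × Fin d) (Fin d × Fin d) ℂ :=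
  Matrix.of fun p q => if p.1 = q.2 ∧ p.2 = q.1 then 1 else 0

theorem trace_maxEnt_mul {c : ℕ} (M : Matrix (Fin c × Fin c) (Fin c × Fin c) ℂ) :
    Matrix.trace (maxEnt c * M) = (1 / (c : ℂ)) * ∑ s, ∑ t, M (t, t) (s, s) := by
  simp [Matrix.trace, Matrix.mul_apply, maxEnt, Fintype.sum_prod_type, Finset.mul_sum, ite_and]

theorem idOnFirst_teleChannel_maxEnt_apply {a c N : ℕ}
    (Pv ω : Fin N → Matrix (Fin a × Fin c) (Fin a × Fin c) ℂ) (s t : Fin c) :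
    idOnFirst (teleChannel Pv ω) (maxEnt c) (t, t) (s, s) =
      (1 / (c : ℂ)) *
        ∑ i, ∑ a₁, ∑ a₂, Pv i (a₁, s) (a₂, t) * ω i (a₂, t) (a₁, s) := by
  simp only [idOnFirst, teleChannel, maxEnt, Matrix.of_apply, ite_and, mul_ite, ite_mul,
    mul_zero, zero_mul, Finset.sum_ite_eq, Finset.mem_univ, if_true, Finset.mul_sum]
  refine Finset.sum_congr rfl fun i _ => Finset.sum_congr rfl fun a₁ _ => ?_
  rw [Finset.sum_comm]
  refine Finset.sum_congr rfl fun a₂ _ => ?_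
  simp only [Finset.sum_ite_eq, Finset.mem_univ, if_true]
  ring

/-- The entanglement fidelity is `|C|⁻² ∑ᵢ tr(Πⁱ ωⁱ)`. -/
theorem entFid_eq_sum_trace {a c N : ℕ}
    (Pv ω : Fin N → Matrix (Fin a × Fin c) (Fin a × Fin c) ℂ) :
    entFid Pv ω = (1 / (c : ℂ) ^ 2) * ∑ i, Matrix.trace (Pv i * ω i) := by
  have hsum : ∑ s, ∑ t, ∑ i, ∑ a₁, ∑ a₂, Pv i (a₁, s) (a₂, t) * ω i (a₂, t) (a₁, s) =
      ∑ i, Matrix.trace (Pv i * ω i) := by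
    simp only [Matrix.trace, Matrix.diag_apply, Matrix.mul_apply, Fintype.sum_prod_type]
    simp_rw [Finset.sum_comm (s := (univ : Finset (Fin c))) (t := (univ : Finset (Fin N)))]
    refine Finset.sum_congr rfl fun i _ => ?_
    rw [Finset.sum_comm (s := (univ : Finset (Fin a))) (t := (univ : Finset (Fin c)))]
    refine Finset.sum_congr rfl fun s _ => ?_
    rw [Finset.sum_comm]
    exact Finset.sum_congr rfl fun a₁ _ => Finset.sum_comm
  rw [entFid, trace_maxEnt_mul]
  simp_rw [idOnFirst_teleChannel_maxEnt_apply, ← Finset.mul_sum]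
  rw [hsum]
  ring

/-- duality between teleportation and dense coding: the entanglement
fidelity of the teleportation protocol and the classical correlation fidelity
`F_cl(W) = (1/N) ∑ᵢ p(i|i)` with `p(j|i) = tr(Πʲ ωⁱ)` of the associated dense coding
protocol satisfy `F(Λ) = (N/|C|²) F_cl(W)`. -/
theorem stmt_12 {a b c N m : ℕ} (hc : 0 < c)
    (ρ : Matrix (Fin a × Fin b) (Fin a × Fin b) ℂ)
    (hρ : ρ.PosSemidef) (hρtr : ρ.trace = 1)
    (Pv : Fin N → Matrix (Fin a × Fin c) (Fin a × Fin c) ℂ)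
    (hPv : ∀ i, (Pv i).PosSemidef) (hPvsum : ∑ i, Pv i = 1)
    (K : Fin N → Fin m → Matrix (Fin c) (Fin b) ℂ)
    (hK : ∀ i, ∑ k, (K i k)ᴴ * K i k = 1) :
    entFid Pv (fun i => idKrausApply (K i) ρ) =
      ((N : ℂ) / (c : ℂ) ^ 2) *
        ((1 / (N : ℂ)) * ∑ i, Matrix.trace (Pv i * idKrausApply (K i) ρ)) := by
  rw [entFid_eq_sum_trace]
  rcases Nat.eq_zero_or_pos N with rfl | hN
  · simp
  · have hN' : (N : ℂ) ≠ 0 := Nat.cast_ne_zero.mpr hN.ne'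
    have hc' : (c : ℂ) ≠ 0 := Nat.cast_ne_zero.mpr hc.ne'
    field_simp
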